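/- Let F be a finite union-closed family of finite sets with ∅ ∈ F whose generators J(F) form a graph, let U = {a, b} ∈ J(F) with a ≠ b, let H be a filter of 2^{N²∖U} such that every minimal member X of H satisfies |E_{F,U}(X)| = 1, and let F' = F ∨ H. Then μ_{F,F'}(U) ≥ 1 + Σ_{Y ⊊ U} Π_{x ∈ N∖U} ν(ℰ(Y,x)), the sum being over the proper subsets Y of U. -/

import Mathlib

open Finset

/-- `F` is union-closed. -/
def UnionClosed {α : Type*} [DecidableEq α] (F : Finset (Finset α)) : Prop :=
  ∀ A ∈ F, ∀ B ∈ F, A ∪ B ∈ F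

/-- The generators `J(F)`: nonempty members of `F` that are not the union of the
members of `F` properly contained in them. -/
def gens {α : Type*} [DecidableEq α] (F : Finset (Finset α)) : Finset (Finset α) :=
  F.filter (fun U => U.Nonempty ∧ (F.filter (fun A => A ⊂ U)).sup id ≠ U)

/-- The closure `π_F(X)`: the union of all members of `F` contained in `X`. -/
def piF {α : Type*} [DecidableEq α] (F : Finset (Finset α)) (X : Finset α) : Finset α :=
  (F.filter (fun A => A ⊆ X)).sup id

/-- `F ∨ H = {A ∪ B : A ∈ F, B ∈ H}`. -/
def famJoin {α : Type*} [DecidableEq α] (F H : Finset (Finset α)) : Finset (Finset α) :=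
  (F ×ˢ H).image (fun p => p.1 ∪ p.2)

/-- `F'` is an extension of `(F, U)`: `F' = F ∨ H` for some nonempty union-closed
family `H` with `(⋃ H) ∩ U = ∅`. -/
def IsExtension {α : Type*} [DecidableEq α] (F : Finset (Finset α)) (U : Finset α)
    (F' : Finset (Finset α)) : Prop :=
  ∃ H : Finset (Finset α), H.Nonempty ∧ UnionClosed H ∧ (H.sup id) ∩ U = ∅ ∧ F' = famJoin F H

/-- The restriction of `F` away from `U`: `F_{∖U} = {A ∖ U : A ∈ F}`. -/
def resAway {α : Type*} [DecidableEq α] (F : Finset (Finset α)) (U : Finset α) :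
    Finset (Finset α) :=
  F.image (fun A => A \ U)

/-- `E_{F,U}(X)`: the subsets `Y ⊆ U` with `π_F(X ∪ Y) ∩ U = Y` and
`π_F(X ∪ Y) ⊇ π_F(X ∪ U) \ U`. -/
def Efam {α : Type*} [DecidableEq α] (F : Finset (Finset α)) (U X : Finset α) :
    Finset (Finset α) :=
  U.powerset.filter (fun Y => piF F (X ∪ Y) ∩ U = Y ∧ piF F (X ∪ U) \ U ⊆ piF F (X ∪ Y))

/-- `μ_{F,F'}(U) = (Σ_{X ∈ F'_{∖U}} |E_{F,U}(X)|) / |F'_{∖U}|`. -/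
def mu {α : Type*} [DecidableEq α] (F : Finset (Finset α)) (U : Finset α)
    (F' : Finset (Finset α)) : ℚ :=
  (∑ X ∈ resAway F' U, ((Efam F U X).card : ℚ)) / ((resAway F' U).card : ℚ)

/-- The union-closed family generated by `G` (all unions of subfamilies of `G`;
it contains `∅` as the empty union). -/
def genUC {α : Type*} [DecidableEq α] (G : Finset (Finset α)) : Finset (Finset α) :=
  G.powerset.image (fun S => S.sup id)

/-- The lattice neighborhood `𝒩_F(U)`: the union-closed family generated by `{∅}`
together with the generators of `F` meeting `U`. -/
def latNbhd {α : Type*} [DecidableEq α] (F : Finset (Finset α)) (U : Finset α) :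
    Finset (Finset α) :=
  genUC ((gens F).filter (fun V => (V ∩ U).Nonempty))

/-- The third lattice neighborhood `𝒩³_F(U) = 𝒩_F(⋃ 𝒩_F(U))`. -/
def latNbhd3 {α : Type*} [DecidableEq α] (F : Finset (Finset α)) (U : Finset α) :
    Finset (Finset α) :=
  latNbhd F ((latNbhd F U).sup id)

/-- The neighborhood `N_F(X) = X ∪ ⋃ {V ∈ J(F) : V ∩ X ≠ ∅}`. -/
def nbhd {α : Type*} [DecidableEq α] (F : Finset (Finset α)) (X : Finset α) : Finset α :=
  X ∪ ((gens F).filter (fun V => (V ∩ X).Nonempty)).sup id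

/-- `H` is a filter of `2^S`: a nonempty family of subsets of `S` closed upward in `S`. -/
def IsFilterOn {α : Type*} [DecidableEq α] (S : Finset α) (H : Finset (Finset α)) : Prop :=
  H.Nonempty ∧ (∀ X ∈ H, X ⊆ S) ∧ ∀ X ∈ H, ∀ Y, X ⊆ Y → Y ⊆ S → Y ∈ H

/-- `F'` minimizes `μ` in `D` (among extensions of `(F, U)` with union inside `D`). -/
def MinimizesMu {α : Type*} [DecidableEq α] (F : Finset (Finset α)) (U D : Finset α)
    (F' : Finset (Finset α)) : Prop :=
  F'.sup id ⊆ D ∧ ∀ F'', IsExtension F U F'' → F''.sup id ⊆ D → mu F U F' ≤ mu F U F''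

/-- The degree of `U` in the graph `G`: the number of members of `G` other than `U`
meeting `U`. -/
def degG {α : Type*} [DecidableEq α] (G : Finset (Finset α)) (U : Finset α) : ℕ :=
  (G.filter (fun V => V ≠ U ∧ (V ∩ U).Nonempty)).card

open scoped Classical in
/-- `ℰ(Y, x)`: the subsets `X` of `N² ∖ U` such that some generator `{x, y}`
of `F` has `y ∈ X ∪ Y` or `y = x`. -/
noncomputable def Escript {α : Type*} [DecidableEq α] (F : Finset (Finset α))
    (U N2 Y : Finset α) (x : α) : Finset (Finset α) :=
  (N2 \ U).powerset.filter
    (fun X => ∃ y, ({x, y} : Finset α) ∈ gens F ∧ (y ∈ X ∪ Y ∨ y = x))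

/-- `ν(H)`: the density of `H` in `2^S`. -/
def nu {α : Type*} (S : Finset α) (H : Finset (Finset α)) : ℚ :=
  (H.card : ℚ) / 2 ^ S.card

section Closure

variable {α : Type*} [DecidableEq α] {F : Finset (Finset α)}

theorem mem_piF {X : Finset α} {x : α} : x ∈ piF F X ↔ ∃ A ∈ F, A ⊆ X ∧ x ∈ A := by
  simp [piF, Finset.mem_sup, and_assoc]

theorem piF_subset (X : Finset α) : piF F X ⊆ X := by
  intro x hx
  obtain ⟨A, -, hAX, hxA⟩ := mem_piF.1 hx
  exact hAX hxA

theorem piF_mono {X Y : Finset α} (h : X ⊆ Y) : piF F X ⊆ piF F Y := by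
  intro x hx
  obtain ⟨A, hA, hAX, hxA⟩ := mem_piF.1 hx
  exact mem_piF.2 ⟨A, hA, hAX.trans h, hxA⟩

theorem piF_mem (hUC : UnionClosed F) (hempty : ∅ ∈ F) (X : Finset α) : piF F X ∈ F := by
  refine Finset.sup_induction (p := fun A => A ∈ F) hempty (fun A hA B hB => hUC A hA B hB) ?_
  intro A hA
  exact (Finset.mem_filter.1 hA).1

/-- Every point of a member of `F` lies in a generator contained in that member. -/
theorem exists_gens_of_mem {A : Finset α} (hA : A ∈ F) {x : α} (hx : x ∈ A) :
    ∃ V ∈ gens F, V ⊆ A ∧ x ∈ V := by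
  induction A using Finset.strongInduction with
  | H A ih =>
    by_cases hs : (F.filter (fun B => B ⊂ A)).sup id = A
    · rw [← hs, Finset.mem_sup] at hx
      obtain ⟨B, hB, hxB⟩ := hx
      obtain ⟨hBF, hBA⟩ := Finset.mem_filter.1 hB
      obtain ⟨V, hV, hVB, hxV⟩ := ih B hBA hBF hxB
      exact ⟨V, hV, hVB.trans hBA.1, hxV⟩
    · exact ⟨A, Finset.mem_filter.2 ⟨hA, ⟨x, hx⟩, hs⟩, Subset.rfl, hx⟩

theorem exists_eq_pair_of_mem_gens (hgraph : ∀ V ∈ gens F, V.card = 1 ∨ V.card = 2)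
    {V : Finset α} (hV : V ∈ gens F) {x : α} (hx : x ∈ V) : ∃ y, V = {x, y} := by
  rcases hgraph V hV with h | h
  · obtain ⟨z, rfl⟩ := Finset.card_eq_one.1 h
    obtain rfl := Finset.mem_singleton.1 hx
    exact ⟨x, by simp⟩
  · obtain ⟨z, w, -, rfl⟩ := Finset.card_eq_two.1 h
    rcases Finset.mem_insert.1 hx with rfl | hx
    · exact ⟨w, rfl⟩
    · obtain rfl := Finset.mem_singleton.1 hx
      exact ⟨z, Finset.pair_comm _ _⟩

theorem mem_piF_iff_pair (hgraph : ∀ V ∈ gens F, V.card = 1 ∨ V.card = 2)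
    {X : Finset α} {x : α} :
    x ∈ piF F X ↔ x ∈ X ∧ ∃ y ∈ X, ({x, y} : Finset α) ∈ gens F := by
  constructor
  · intro hx
    refine ⟨piF_subset X hx, ?_⟩
    obtain ⟨A, hA, hAX, hxA⟩ := mem_piF.1 hx
    obtain ⟨V, hV, hVA, hxV⟩ := exists_gens_of_mem hA hxA
    obtain ⟨y, rfl⟩ := exists_eq_pair_of_mem_gens hgraph hV hxV
    exact ⟨y, hAX (hVA (by simp)), hV⟩
  · rintro ⟨hx, y, hy, hg⟩
    refine mem_piF.2 ⟨_, (Finset.mem_filter.1 hg).1, ?_, by simp⟩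
    simp [Finset.insert_subset_iff, hx, hy]

theorem subset_nbhd (Z : Finset α) : Z ⊆ nbhd F Z := Finset.subset_union_left

theorem mem_nbhd_of_pair {Z : Finset α} {x y : α} (hy : y ∈ Z)
    (hg : ({x, y} : Finset α) ∈ gens F) : x ∈ nbhd F Z := by
  refine Finset.mem_union_right _ (Finset.mem_sup.2 ⟨{x, y}, ?_, by simp⟩)
  exact Finset.mem_filter.2 ⟨hg, y, by simp [hy]⟩

theorem exists_pair_of_mem_nbhd (hgraph : ∀ V ∈ gens F, V.card = 1 ∨ V.card = 2)
    {Z : Finset α} {x : α} (hx : x ∈ nbhd F Z) (hxZ : x ∉ Z) :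
    ∃ y ∈ Z, ({x, y} : Finset α) ∈ gens F := by
  rcases Finset.mem_union.1 hx with hx | hx
  · exact absurd hx hxZ
  obtain ⟨V, hV, hxV⟩ := Finset.mem_sup.1 hx
  obtain ⟨hV, z, hz⟩ := Finset.mem_filter.1 hV
  obtain ⟨hzV, hzZ⟩ := Finset.mem_inter.1 hz
  obtain ⟨y, rfl⟩ := exists_eq_pair_of_mem_gens hgraph hV hxV
  have hzy : z = x ∨ z = y := by simpa using hzV
  rcases hzy with rfl | rfl
  · exact absurd hzZ hxZ
  · exact ⟨z, hzZ, hV⟩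

theorem mem_Efam_of_forall (hgraph : ∀ V ∈ gens F, V.card = 1 ∨ V.card = 2)
    {U X Y : Finset α} (hYU : Y ⊆ U) (hXU : Disjoint X U)
    (hY : ∀ y ∈ Y, y ∈ piF F (X ∪ Y))
    (hX : ∀ x ∈ X, x ∈ nbhd F U → x ∈ piF F (X ∪ Y)) : Y ∈ Efam F U X := by
  refine Finset.mem_filter.2 ⟨Finset.mem_powerset.2 hYU, ?_, ?_⟩
  · ext y
    refine ⟨fun hy => ?_, fun hy => Finset.mem_inter.2 ⟨hY y hy, hYU hy⟩⟩
    obtain ⟨hy1, hy2⟩ := Finset.mem_inter.1 hy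
    rcases Finset.mem_union.1 (piF_subset _ hy1) with h | h
    · exact absurd hy2 (Finset.disjoint_left.1 hXU h)
    · exact h
  · intro x hx
    obtain ⟨hx, hxU⟩ := Finset.mem_sdiff.1 hx
    obtain ⟨hxX, y, hy, hg⟩ := (mem_piF_iff_pair hgraph).1 hx
    have hxX : x ∈ X := (Finset.mem_union.1 hxX).resolve_right hxU
    rcases Finset.mem_union.1 hy with hy | hy
    · exact (mem_piF_iff_pair hgraph).2
        ⟨Finset.mem_union_left _ hxX, y, Finset.mem_union_left _ hy, hg⟩
    · exact hX x hxX (mem_nbhd_of_pair hy hg)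

theorem self_mem_Efam {U X : Finset α} (hU : U ∈ F) : U ∈ Efam F U X := by
  refine Finset.mem_filter.2 ⟨Finset.mem_powerset_self U, ?_, Finset.sdiff_subset⟩
  refine Finset.Subset.antisymm Finset.inter_subset_right fun u hu => ?_
  exact Finset.mem_inter.2 ⟨mem_piF.2 ⟨U, hU, Finset.subset_union_right, hu⟩, hu⟩

/-- If `U = {a, b}` is the only element of `E_{F,U}(X)`, then `a` is covered in `X ∪ {a}`. -/
theorem mem_piF_union_singleton (hgraph : ∀ V ∈ gens F, V.card = 1 ∨ V.card = 2)
    {a b : α} (hab : a ≠ b) (hU : ({a, b} : Finset α) ∈ F) {X : Finset α}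
    (hXU : Disjoint X {a, b}) (hE : (Efam F {a, b} X).card = 1) :
    a ∈ piF F (X ∪ {a}) := by
  by_contra ha
  have hne : ∀ Y ∈ Efam F {a, b} X, Y = {a, b} := fun Y hY =>
    Finset.card_le_one.1 hE.le Y hY _ (self_mem_Efam hU)
  have hadj : ∀ x ∈ X, x ∈ nbhd F {a, b} → ({x, b} : Finset α) ∈ gens F := by
    intro x hx hxN
    obtain ⟨y, hy, hg⟩ := exists_pair_of_mem_nbhd hgraph hxN (Finset.disjoint_left.1 hXU hx)
    have hy : y = a ∨ y = b := by simpa using hy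
    rcases hy with rfl | rfl
    · refine absurd ((mem_piF_iff_pair hgraph).2 ⟨by simp, x, by simp [hx], ?_⟩) ha
      rwa [Finset.pair_comm]
    · exact hg
  by_cases hb : b ∈ piF F (X ∪ {b})
  · have := hne {b} (mem_Efam_of_forall hgraph (by simp) hXU (by simpa using hb)
      fun x hx hxN => (mem_piF_iff_pair hgraph).2 ⟨by simp [hx], b, by simp, hadj x hx hxN⟩)
    have h : a ∈ ({b} : Finset α) := this ▸ (by simp)
    exact hab (by simpa using h)
  · have := hne ∅ (mem_Efam_of_forall hgraph (by simp) hXU (by simp) fun x hx hxN => by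
      refine absurd ((mem_piF_iff_pair hgraph).2 ⟨by simp, x, by simp [hx], ?_⟩) hb
      rw [Finset.pair_comm]
      exact hadj x hx hxN)
    have h : a ∈ (∅ : Finset α) := this ▸ (by simp)
    simp at h

end Closure

theorem exists_minimal_subset {α : Type*} {H : Finset (Finset α)} {X : Finset α}
    (hX : X ∈ H) :
    ∃ M ∈ H, M ⊆ X ∧ ∀ Z, Z ⊂ M → Z ∉ H := by
  induction X using Finset.strongInduction with
  | H X ih =>
    by_cases h : ∀ Z, Z ⊂ X → Z ∉ H
    · exact ⟨X, hX, Subset.rfl, h⟩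
    · push Not at h
      obtain ⟨Z, hZX, hZ⟩ := h
      obtain ⟨M, hM, hMZ, hmin⟩ := ih Z hZX hZ
      exact ⟨M, hM, hMZ.trans hZX.1, hmin⟩

section Correlation

variable {α : Type*} [DecidableEq α]

/-- The Harris–Kleitman inequality for two up-sets of the powerset of `S`. -/
theorem card_mul_card_le_of_upClosed {S : Finset α} {A B : Finset (Finset α)}
    (hAS : ∀ X ∈ A, X ⊆ S) (hBS : ∀ X ∈ B, X ⊆ S)
    (hA : ∀ X ∈ A, ∀ Y, X ⊆ Y → Y ⊆ S → Y ∈ A) (hB : ∀ X ∈ B, ∀ Y, X ⊆ Y → Y ⊆ S → Y ∈ B) :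
    A.card * B.card ≤ 2 ^ S.card * (A ∩ B).card := by
  refine (Finset.le_card_infs_mul_card_sups A B).trans (Nat.mul_le_mul ?_ ?_)
  · rw [← Finset.card_powerset]
    refine Finset.card_le_card fun Z hZ => ?_
    obtain ⟨X, hX, Y, hY, rfl⟩ := Finset.mem_infs.1 hZ
    exact Finset.mem_powerset.2 (Finset.inter_subset_left.trans (hAS X hX))
  · refine Finset.card_le_card fun Z hZ => ?_
    obtain ⟨X, hX, Y, hY, rfl⟩ := Finset.mem_sups.1 hZ
    have hS : X ∪ Y ⊆ S := Finset.union_subset (hAS X hX) (hBS Y hY)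
    exact Finset.mem_inter.2 ⟨hA X hX _ Finset.subset_union_left hS,
      hB Y hY _ Finset.subset_union_right hS⟩

theorem card_mul_prod_nu_le {ι : Type*} [DecidableEq ι] {S : Finset α} {A : Finset (Finset α)}
    (hAS : ∀ X ∈ A, X ⊆ S) (hA : ∀ X ∈ A, ∀ Y, X ⊆ Y → Y ⊆ S → Y ∈ A)
    (G : ι → Finset (Finset α)) (hGS : ∀ i, ∀ X ∈ G i, X ⊆ S)
    (hG : ∀ i, ∀ X ∈ G i, ∀ Y, X ⊆ Y → Y ⊆ S → Y ∈ G i) (I : Finset ι) :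
    (A.card : ℚ) * ∏ i ∈ I, nu S (G i) ≤ ((A.filter (fun X => ∀ i ∈ I, X ∈ G i)).card : ℚ) := by
  induction I using Finset.induction_on with
  | empty => simp
  | insert i I hi ih =>
    have h := card_mul_card_le_of_upClosed (S := S)
      (A := A.filter (fun X => ∀ i ∈ I, X ∈ G i)) (B := G i)
      (fun X hX => hAS X (Finset.mem_filter.1 hX).1) (hGS i)
      (fun X hX Y hXY hYS => by
        obtain ⟨hX, hXI⟩ := Finset.mem_filter.1 hX
        exact Finset.mem_filter.2
          ⟨hA X hX Y hXY hYS, fun j hj => hG j X (hXI j hj) Y hXY hYS⟩) (hG i)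
    have heq : A.filter (fun X => ∀ j ∈ insert i I, X ∈ G j) =
        A.filter (fun X => ∀ j ∈ I, X ∈ G j) ∩ G i := by
      ext X
      simp only [Finset.mem_filter, Finset.mem_inter, Finset.forall_mem_insert]
      tauto
    have hnu : 0 ≤ nu S (G i) := by unfold nu; positivity
    rw [Finset.prod_insert hi, heq]
    calc (A.card : ℚ) * (nu S (G i) * ∏ j ∈ I, nu S (G j))
        = (A.card * ∏ j ∈ I, nu S (G j)) * nu S (G i) := by ring
      _ ≤ (A.filter (fun X => ∀ j ∈ I, X ∈ G j)).card * nu S (G i) := by gcongr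
      _ ≤ _ := by
        unfold nu
        rw [← mul_div_assoc, div_le_iff₀ (by positivity), mul_comm (Finset.card _ : ℚ) (2 ^ _)]
        exact_mod_cast h

/-- The correlation inequality for a family whose fibres over the trace outside `S` are
up-closed in `S`. -/
theorem card_mul_prod_nu_le_of_fibers {ι : Type*} [DecidableEq ι] {S : Finset α}
    {R : Finset (Finset α)}
    (hR : ∀ X ∈ R, ∀ B, X ∩ S ⊆ B → B ⊆ S → X \ S ∪ B ∈ R)
    (G : ι → Finset (Finset α)) (hGS : ∀ i, ∀ X ∈ G i, X ⊆ S)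
    (hG : ∀ i, ∀ X ∈ G i, ∀ Y, X ⊆ Y → Y ⊆ S → Y ∈ G i) (I : Finset ι) :
    (R.card : ℚ) * ∏ i ∈ I, nu S (G i) ≤
      ((R.filter (fun X => ∀ i ∈ I, X ∩ S ∈ G i)).card : ℚ) := by
  have hmaps : ∀ X ∈ R, X \ S ∈ R.image (· \ S) := fun X hX => Finset.mem_image_of_mem _ hX
  rw [Finset.card_eq_sum_card_fiberwise (f := (· \ S)) (t := R.image (· \ S)) hmaps,
    Finset.card_eq_sum_card_fiberwise (s := R.filter _) (f := (· \ S)) (t := R.image (· \ S))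
      (fun X hX => hmaps X (Finset.mem_filter.1 hX).1)]
  push_cast
  rw [Finset.sum_mul]
  refine Finset.sum_le_sum fun T _ => ?_
  have hinj : Set.InjOn (· ∩ S) {X : Finset α | X \ S = T} := by
    intro X hX Y hY hXY
    rw [← Finset.sdiff_union_inter X S, ← Finset.sdiff_union_inter Y S]
    simp only [Set.mem_ofPred_eq] at hX hY hXY
    rw [hX, hY, hXY]
  have h := card_mul_prod_nu_le (S := S) (A := (R.filter (fun X => X \ S = T)).image (· ∩ S))
    (by
      intro X hX
      obtain ⟨Z, -, rfl⟩ := Finset.mem_image.1 hX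
      exact Finset.inter_subset_right)
    (by
      intro X hX Y hXY hYS
      obtain ⟨Z, hZ, rfl⟩ := Finset.mem_image.1 hX
      obtain ⟨hZR, rfl⟩ := Finset.mem_filter.1 hZ
      refine Finset.mem_image.2 ⟨Z \ S ∪ Y, Finset.mem_filter.2 ⟨hR Z hZR Y hXY hYS, ?_⟩, ?_⟩
      · ext x
        have := @hYS x
        simp only [Finset.mem_sdiff, Finset.mem_union]
        tauto
      · ext x
        have := @hYS x
        simp only [Finset.mem_sdiff, Finset.mem_union, Finset.mem_inter]
        tauto)
    G hGS hG I
  rw [Finset.filter_image, Finset.card_image_of_injOn (hinj.mono (by simp)),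
    Finset.card_image_of_injOn (hinj.mono (by intro X hX; simp at hX; exact hX.1.2)),
    Finset.filter_comm] at h
  exact h

end Correlation

section Extension

variable {α : Type*} [DecidableEq α] {F : Finset (Finset α)}

theorem mem_resAway_famJoin {H : Finset (Finset α)} {U X : Finset α} :
    X ∈ resAway (famJoin F H) U ↔ ∃ A ∈ F, ∃ B ∈ H, (A ∪ B) \ U = X := by
  simp only [resAway, famJoin, Finset.mem_image, Finset.mem_product, Prod.exists]
  constructor
  · rintro ⟨_, ⟨A, B, ⟨hA, hB⟩, rfl⟩, rfl⟩
    exact ⟨A, hA, B, hB, rfl⟩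
  · rintro ⟨A, hA, B, hB, rfl⟩
    exact ⟨_, ⟨A, B, ⟨hA, hB⟩, rfl⟩, rfl⟩

theorem disjoint_of_mem_resAway {F' : Finset (Finset α)} {U X : Finset α}
    (hX : X ∈ resAway F' U) : Disjoint X U := by
  obtain ⟨A, -, rfl⟩ := Finset.mem_image.1 hX
  exact Finset.sdiff_disjoint

theorem sdiff_union_mem_resAway (hUC : UnionClosed F) (hempty : ∅ ∈ F)
    (hgraph : ∀ V ∈ gens F, V.card = 1 ∨ V.card = 2) {U S : Finset α}
    (hS : S = nbhd F (nbhd F U) \ U) {H : Finset (Finset α)} (hH : IsFilterOn S H)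
    {X : Finset α} (hX : X ∈ resAway (famJoin F H) U) {B : Finset α}
    (hXB : X ∩ S ⊆ B) (hBS : B ⊆ S) : X \ S ∪ B ∈ resAway (famJoin F H) U := by
  have hXU := disjoint_of_mem_resAway hX
  have hSU : Disjoint S U := hS ▸ Finset.sdiff_disjoint
  obtain ⟨A, hA, C, hC, rfl⟩ := mem_resAway_famJoin.1 hX
  have hCS := hH.2.1 C hC
  have hCB : C ⊆ B := fun x hx => hXB (by
    simp [hx, hCS hx, Finset.disjoint_left.1 hSU (hCS hx)])
  have hBH : B ∈ H := hH.2.2 C hC B hCB hBS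
  set X := (A ∪ C) \ U with hXdef
  refine mem_resAway_famJoin.2 ⟨piF F X, piF_mem hUC hempty X, B, hBH, ?_⟩
  have hcov : X \ S ⊆ piF F X := by
    intro t ht
    obtain ⟨htX, htS⟩ := Finset.mem_sdiff.1 ht
    have htU : t ∉ U := Finset.disjoint_left.1 hXU htX
    have htN : t ∉ nbhd F (nbhd F U) := fun h => htS (hS ▸ Finset.mem_sdiff.2 ⟨h, htU⟩)
    have htA : t ∈ A := by
      rcases Finset.mem_union.1 (Finset.mem_sdiff.1 htX).1 with h | h
      · exact h
      · exact absurd (hCS h) htS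
    obtain ⟨V, hV, hVA, htV⟩ := exists_gens_of_mem hA htA
    obtain ⟨y, rfl⟩ := exists_eq_pair_of_mem_gens hgraph hV htV
    refine (mem_piF_iff_pair hgraph).2 ⟨htX, y, ?_, hV⟩
    refine Finset.mem_sdiff.2 ⟨Finset.mem_union_left _ (hVA (by simp)), fun hyU => htN ?_⟩
    exact mem_nbhd_of_pair (subset_nbhd U hyU) hV
  ext x
  have h1 := @hcov x
  have h2 := @hXB x
  have h3 := @hBS x
  have h4 := @piF_subset _ _ F X x
  have h5 : x ∈ X → x ∉ U := fun h => Finset.disjoint_left.1 hXU h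
  have h6 : x ∈ S → x ∉ U := fun h => Finset.disjoint_left.1 hSU h
  clear_value X
  simp only [Finset.mem_sdiff, Finset.mem_union, Finset.mem_inter] at h1 h2 ⊢
  tauto

theorem mem_Escript {U N2 Y X : Finset α} {x : α} :
    X ∈ Escript F U N2 Y x ↔
      X ⊆ N2 \ U ∧ ∃ y, ({x, y} : Finset α) ∈ gens F ∧ (y ∈ X ∪ Y ∨ y = x) := by
  simp only [Escript, Finset.mem_filter, Finset.mem_powerset]

end Extension

/-- Theorem 3.26: with `J(F)` a graph, `U = {a, b} ∈ J(F)` (`a ≠ b`), `H` a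
filter of `2^{N²∖U}` whose minimal members `X` satisfy `|E_{F,U}(X)| = 1`, and
`F' = F ∨ H`, we have `μ_{F,F'}(U) ≥ 1 + Σ_{Y ⊊ U} Π_{x ∈ N∖U} ν(ℰ(Y,x))`. -/
theorem stmt17 {α : Type*} [DecidableEq α] (F : Finset (Finset α))
    (hUC : UnionClosed F) (hempty : ∅ ∈ F)
    (hgraph : ∀ V ∈ gens F, V.card = 1 ∨ V.card = 2)
    (a b : α) (hab : a ≠ b) (hU : ({a, b} : Finset α) ∈ gens F)
    (H : Finset (Finset α))
    (hH : IsFilterOn (nbhd F (nbhd F {a, b}) \ {a, b}) H)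
    (hmin : ∀ X ∈ H, (∀ Z, Z ⊂ X → Z ∉ H) → (Efam F {a, b} X).card = 1) :
    1 + ∑ Y ∈ ({a, b} : Finset α).powerset.filter (fun Y => Y ⊂ ({a, b} : Finset α)),
        ∏ x ∈ nbhd F {a, b} \ {a, b},
          nu (nbhd F (nbhd F {a, b}) \ {a, b})
            (Escript F {a, b} (nbhd F (nbhd F {a, b})) Y x) ≤
      mu F {a, b} (famJoin F H) := by
  set U : Finset α := {a, b} with hUdef
  set S := nbhd F (nbhd F U) \ U with hS
  set R := resAway (famJoin F H) U with hR
  have hUF : U ∈ F := (Finset.mem_filter.1 hU).1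
  have hSU : Disjoint S U := Finset.sdiff_disjoint
  have hcover : ∀ X ∈ R, ∀ y ∈ U, y ∈ piF F (X ∪ {y}) := by
    intro X hX y hy
    obtain ⟨A, -, B, hB, rfl⟩ := mem_resAway_famJoin.1 hX
    obtain ⟨M, hM, hMB, hMmin⟩ := exists_minimal_subset hB
    have hMU : Disjoint M U := hSU.mono_left (hH.2.1 M hM)
    have hMX : M ⊆ (A ∪ B) \ U := fun x hx => Finset.mem_sdiff.2
      ⟨Finset.mem_union_right _ (hMB hx), Finset.disjoint_left.1 hMU hx⟩
    refine piF_mono (Finset.union_subset_union_left hMX) ?_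
    have hE := hmin M hM hMmin
    have hy : y = a ∨ y = b := by simpa [hUdef] using hy
    rcases hy with rfl | rfl
    · exact mem_piF_union_singleton hgraph hab hUF hMU hE
    · rw [hUdef, Finset.pair_comm] at hUF hMU hE
      exact mem_piF_union_singleton hgraph hab.symm hUF hMU hE
  have hterm : ∀ Y, Y ⊂ U →
      (R.card : ℚ) * ∏ x ∈ nbhd F U \ U, nu S (Escript F U (nbhd F (nbhd F U)) Y x) ≤
        ((R.filter (fun X => Y ∈ Efam F U X)).card : ℚ) := by
    intro Y hY
    refine (card_mul_prod_nu_le_of_fibers (S := S) (R := R)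
      (fun X hX B hXB hBS => sdiff_union_mem_resAway hUC hempty hgraph hS hH hX hXB hBS)
      (fun x => Escript F U (nbhd F (nbhd F U)) Y x) (fun x X hX => (mem_Escript.1 hX).1)
      ?_ _).trans ?_
    · intro x X hX Z hXZ hZS
      obtain ⟨-, y, hg, hy⟩ := mem_Escript.1 hX
      exact mem_Escript.2 ⟨hZS, y, hg, hy.imp_left fun h =>
        Finset.union_subset_union_left hXZ h⟩
    · refine Nat.cast_le.2 (Finset.card_le_card fun X hX => ?_)
      obtain ⟨hXR, hXE⟩ := Finset.mem_filter.1 hX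
      have hXU := disjoint_of_mem_resAway hXR
      refine Finset.mem_filter.2 ⟨hXR, mem_Efam_of_forall hgraph hY.1 hXU ?_ ?_⟩
      · intro y hy
        exact piF_mono (Finset.union_subset_union_right (by simpa using hy))
          (hcover X hXR y (hY.1 hy))
      · intro x hx hxN
        obtain ⟨-, y, hg, hy⟩ := mem_Escript.1
          (hXE x (Finset.mem_sdiff.2 ⟨hxN, Finset.disjoint_left.1 hXU hx⟩))
        refine (mem_piF_iff_pair hgraph).2 ⟨Finset.mem_union_left _ hx, y, ?_, hg⟩
        rcases hy with hy | rfl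
        · exact Finset.union_subset_union_left Finset.inter_subset_left hy
        · exact Finset.mem_union_left _ hx
  have hRpos : (0 : ℚ) < R.card := by
    obtain ⟨B, hB⟩ := hH.1
    exact Nat.cast_pos.2 (Finset.card_pos.2
      ⟨_, mem_resAway_famJoin.2 ⟨∅, hempty, B, hB, rfl⟩⟩)
  have hcard : ∀ X ∈ R, 1 + ∑ Y ∈ U.powerset.filter (fun Y => Y ⊂ U),
      (if Y ∈ Efam F U X then (1 : ℚ) else 0) ≤ ((Efam F U X).card : ℚ) := by
    intro X hX
    rw [Finset.sum_boole]
    have hnot : U ∉ (U.powerset.filter (fun Y => Y ⊂ U)).filter (fun Y => Y ∈ Efam F U X) := by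
      simp
    have hsub : insert U ((U.powerset.filter (fun Y => Y ⊂ U)).filter
        (fun Y => Y ∈ Efam F U X)) ⊆ Efam F U X :=
      Finset.insert_subset (self_mem_Efam hUF)
        fun Y hY => (Finset.mem_filter.1 hY).2
    have h := Finset.card_le_card hsub
    rw [Finset.card_insert_of_notMem hnot, add_comm] at h
    exact_mod_cast h
  unfold mu
  rw [le_div_iff₀ hRpos]
  refine le_trans ?_ (Finset.sum_le_sum hcard)
  rw [Finset.sum_add_distrib, Finset.sum_comm, add_mul, Finset.sum_mul]
  refine add_le_add (by simp [hR]) (Finset.sum_le_sum fun Y hY => ?_)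
  rw [Finset.sum_boole, mul_comm]
  exact hterm Y (Finset.mem_filter.1 hY).2
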